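/- (Bernstein–McMullen) Let P_1, …, P_k be lattice polytopes in ℝ^d. Then there is a polynomial E_𝐏 in k variables such that E_𝐏(n_1,…,n_k) = |(n_1P_1 + ⋯ + n_kP_k) ∩ ℤ^d| for all integers n_1,…,n_k ≥ 0; moreover, the degree of E_𝐏 in the variable n_i equals dim P_i, and its total degree equals dim(P_1 + ⋯ + P_k). -/

import Mathlib

open Pointwise MeasureTheory Filter
open scoped Classical

/-- A lattice polytope in `ℝ^d`: the convex hull of finitely many integer points. -/
def IsLatticePolytope {d : ℕ} (P : Set (Fin d → ℝ)) : Prop :=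
  ∃ V : Finset (Fin d → ℤ), V.Nonempty ∧
    P = convexHull ℝ ((fun z : Fin d → ℤ => fun i => (z i : ℝ)) '' ↑V)

/-- The number of lattice points of a subset of `ℝ^d`. -/
noncomputable def latticePointCount {d : ℕ} (P : Set (Fin d → ℝ)) : ℕ :=
  Set.ncard {z : Fin d → ℤ | (fun i => (z i : ℝ)) ∈ P}

/-- The discrete mixed volume `DMV(P_1, …, P_k)`; here `∑ j ∈ J, P j` is a Minkowski
sum of sets, with the empty sum being `{0}`. -/
noncomputable def DMV {d k : ℕ} (P : Fin k → Set (Fin d → ℝ)) : ℤ :=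
  ∑ J : Finset (Fin k), (-1) ^ (k - J.card) * (latticePointCount (∑ j ∈ J, P j) : ℤ)

/-- The dimension of a polytope: the dimension of its affine hull. -/
noncomputable def polytopeDim {d : ℕ} (P : Set (Fin d → ℝ)) : ℕ :=
  Module.finrank ℝ (affineSpan ℝ P).direction

/-- A positive vector can be chosen off finitely many hyperplanes. -/
theorem exists_pos_forall_sum_mul_ne_zero {ι : Type*} [Fintype ι] (Γ : Finset (ι → ℝ))
    (hΓ : ∀ γ ∈ Γ, γ ≠ 0) :
    ∃ c : ι → ℝ, (∀ j, 0 < c j) ∧ ∀ γ ∈ Γ, ∑ j, c j * γ j ≠ 0 := by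
  induction Γ using Finset.induction_on with
  | empty => exact ⟨fun _ => 1, fun _ => one_pos, by simp⟩
  | insert γ Γ _ ih =>
    obtain ⟨c, hc, hcΓ⟩ := ih fun γ' h => hΓ γ' (Finset.mem_insert_of_mem h)
    have hγ : γ ≠ 0 := hΓ γ (Finset.mem_insert_self _ _)
    have hsq : 0 < ∑ j, γ j * γ j := by
      obtain ⟨j, hj⟩ := Function.ne_iff.1 hγ
      exact Finset.sum_pos' (fun i _ => mul_self_nonneg _)
        ⟨j, Finset.mem_univ _, mul_self_pos.2 hj⟩
    by_cases h0 : ∑ j, c j * γ j = 0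
    · have h1 : ∀ᶠ s : ℝ in nhdsWithin 0 (Set.Ioi 0), ∀ j, 0 < c j + s * γ j := by
        refine Filter.eventually_all.2 fun j => ?_
        have : Tendsto (fun s : ℝ => c j + s * γ j) (nhdsWithin 0 (Set.Ioi 0)) (nhds (c j)) := by
          have : Continuous fun s : ℝ => c j + s * γ j := by fun_prop
          simpa using (this.tendsto 0).mono_left nhdsWithin_le_nhds
        exact this.eventually (lt_mem_nhds (hc j))
      have h2 : ∀ᶠ s : ℝ in nhdsWithin 0 (Set.Ioi 0),
          ∀ γ' ∈ Γ, ∑ j, (c j + s * γ j) * γ' j ≠ 0 := by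
        refine (Filter.eventually_all_finset Γ).2 fun γ' h' => ?_
        have : Tendsto (fun s : ℝ => ∑ j, (c j + s * γ j) * γ' j) (nhdsWithin 0 (Set.Ioi 0))
            (nhds (∑ j, c j * γ' j)) := by
          have : Continuous fun s : ℝ => ∑ j, (c j + s * γ j) * γ' j := by fun_prop
          simpa using (this.tendsto 0).mono_left nhdsWithin_le_nhds
        exact this.eventually_ne (hcΓ γ' h')
      obtain ⟨s, ⟨hs1, hs2⟩, hs⟩ := ((h1.and h2).and self_mem_nhdsWithin).exists
      refine ⟨fun j => c j + s * γ j, hs1, fun γ' h' => ?_⟩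
      rcases Finset.mem_insert.1 h' with rfl | h'
      · simp only [add_mul, Finset.sum_add_distrib, h0, zero_add, mul_assoc, ← Finset.mul_sum]
        exact mul_ne_zero (ne_of_gt hs) hsq.ne'
      · exact hs2 γ' h'
    · refine ⟨c, hc, fun γ' h' => ?_⟩
      rcases Finset.mem_insert.1 h' with rfl | hmem
      · exact h0
      · exact hcΓ _ hmem

/-- `B` is a basis of the range of `L`, and it is the unique optimal one for the linear program
with costs `c`: moving along the kernel of `L` away from a point supported on `B` increases the
cost. -/
structure IsOptimalBasis {ι E : Type*} [Fintype ι] [AddCommGroup E] [Module ℝ E]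
    (L : (ι → ℝ) →ₗ[ℝ] E) (c : ι → ℝ) (B : Finset ι) : Prop where
  exists_eq : ∀ x, ∃ γ : ι → ℝ, (∀ j ∉ B, γ j = 0) ∧ L γ = L x
  cost_pos : ∀ γ, L γ = 0 → (∀ j ∉ B, 0 ≤ γ j) → γ ≠ 0 → 0 < ∑ j, c j * γ j

section LinearProgram

variable {ι E : Type*} [Fintype ι] [AddCommGroup E] [Module ℝ E]
  {L : (ι → ℝ) →ₗ[ℝ] E} {c : ι → ℝ} {B : Finset ι}

theorem IsOptimalBasis.eq_zero (h : IsOptimalBasis L c B) {γ : ι → ℝ}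
    (hγ : ∀ j ∉ B, γ j = 0) (h0 : L γ = 0) : γ = 0 := by
  by_contra hne
  have h1 := h.cost_pos γ h0 (fun j hj => (hγ j hj).ge) hne
  have h2 := h.cost_pos (-γ) (by simp [h0]) (fun j hj => by simp [hγ j hj]) (neg_ne_zero.2 hne)
  simp only [Pi.neg_apply, mul_neg, Finset.sum_neg_distrib] at h2
  linarith

theorem IsOptimalBasis.eq_of_map_eq (h : IsOptimalBasis L c B) {γ δ : ι → ℝ}
    (hγ : ∀ j ∉ B, γ j = 0) (hδ : ∀ j ∉ B, δ j = 0) (h0 : L γ = L δ) : γ = δ :=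
  sub_eq_zero.1 <| h.eq_zero (fun j hj => by simp [hγ j hj, hδ j hj]) (by simp [h0])

theorem IsOptimalBasis.unique {B' : Finset ι} (h : IsOptimalBasis L c B)
    (h' : IsOptimalBasis L c B') {γ γ' : ι → ℝ} (hγ : ∀ j ∉ B, γ j = 0) (hγ' : ∀ j ∉ B', γ' j = 0)
    (hpos : ∀ j ∈ B, 0 < γ j) (hpos' : ∀ j ∈ B', 0 < γ' j) (heq : L γ = L γ') : B = B' := by
  have key : γ = γ' := by
    by_contra hne
    have nn : ∀ j, 0 ≤ γ j := fun j => by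
      by_cases hj : j ∈ B
      · exact (hpos j hj).le
      · exact (hγ j hj).ge
    have nn' : ∀ j, 0 ≤ γ' j := fun j => by
      by_cases hj : j ∈ B'
      · exact (hpos' j hj).le
      · exact (hγ' j hj).ge
    have h1 := h.cost_pos (γ' - γ) (by simp [heq]) (fun j hj => by simp [hγ j hj, nn' j])
      (sub_ne_zero.2 (Ne.symm hne))
    have h2 := h'.cost_pos (γ - γ') (by simp [heq]) (fun j hj => by simp [hγ' j hj, nn j])
      (sub_ne_zero.2 hne)
    simp only [Pi.sub_apply, mul_sub, Finset.sum_sub_distrib] at h1 h2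
    linarith
  subst key
  ext j
  constructor
  · intro hj
    by_contra hj'
    exact (hpos j hj).ne' (hγ' j hj')
  · intro hj
    by_contra hjB
    exact (hpos' j hj).ne' (hγ j hjB)

/-- A linear program with positive costs attains its minimum. -/
theorem exists_min_cost (L : (ι → ℝ) →ₗ[ℝ] E) (hc : ∀ j, 0 < c j) (x : ι → ℝ)
    (hx : ∀ j, 0 ≤ x j) :
    ∃ y : ι → ℝ, (∀ j, 0 ≤ y j) ∧ L y = L x ∧
      ∀ z : ι → ℝ, (∀ j, 0 ≤ z j) → L z = L x → ∑ j, c j * y j ≤ ∑ j, c j * z j := by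
  set K : Set (ι → ℝ) := {y | (∀ j, 0 ≤ y j) ∧ L y = L x ∧ ∑ j, c j * y j ≤ ∑ j, c j * x j} with hK
  have hcont : Continuous fun y : ι → ℝ => ∑ j, c j * y j := by fun_prop
  have hclosed : IsClosed K := by
    have h1 : IsClosed {y : ι → ℝ | ∀ j, 0 ≤ y j} := by
      simp only [Set.ofPred_forall]
      exact isClosed_iInter fun j => isClosed_le continuous_const (continuous_apply j)
    have h2 : IsClosed {y : ι → ℝ | L y = L x} := by
      have : {y : ι → ℝ | L y = L x} = (fun y => y - x) ⁻¹' (LinearMap.ker L : Set (ι → ℝ)) := by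
        ext y; simp [sub_eq_zero]
      rw [this]
      exact (Submodule.closed_of_finiteDimensional _).preimage (by fun_prop)
    exact h1.inter (h2.inter (isClosed_le hcont continuous_const))
  have hcomp : IsCompact K := by
    refine IsCompact.of_isClosed_subset
      (isCompact_Icc (a := (0 : ι → ℝ)) (b := fun j => (∑ j, c j * x j) / c j)) hclosed ?_
    rintro y ⟨hy, -, hle⟩
    refine ⟨hy, fun j => ?_⟩
    rw [le_div_iff₀ (hc j), mul_comm]
    exact (Finset.single_le_sum (f := fun j => c j * y j)
      (fun i _ => mul_nonneg (hc i).le (hy i)) (Finset.mem_univ j)).trans hle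
  obtain ⟨y, hy, hmin⟩ := hcomp.exists_isMinOn ⟨x, hx, rfl, le_rfl⟩ hcont.continuousOn
  refine ⟨y, hy.1, hy.2.1, fun z hz hzx => ?_⟩
  by_cases hle : ∑ j, c j * z j ≤ ∑ j, c j * x j
  · exact hmin ⟨hz, hzx, hle⟩
  · exact hy.2.2.trans (not_le.1 hle).le

theorem cost_nonneg_of_min {y : ι → ℝ} (hy : ∀ j, 0 ≤ y j)
    (hmin : ∀ z : ι → ℝ, (∀ j, 0 ≤ z j) → L z = L y → ∑ j, c j * y j ≤ ∑ j, c j * z j)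
    {γ : ι → ℝ} (hγ : L γ = 0) (hnn : ∀ j, y j = 0 → 0 ≤ γ j) : 0 ≤ ∑ j, c j * γ j := by
  have h1 : ∀ᶠ s : ℝ in nhdsWithin 0 (Set.Ioi 0), ∀ j, 0 ≤ y j + s * γ j := by
    refine Filter.eventually_all.2 fun j => ?_
    rcases (hy j).eq_or_lt with h | h
    · filter_upwards [self_mem_nhdsWithin] with s hs
      rw [← h, zero_add]
      exact mul_nonneg (le_of_lt hs) (hnn j h.symm)
    · have : Tendsto (fun s : ℝ => y j + s * γ j) (nhdsWithin 0 (Set.Ioi 0)) (nhds (y j)) := by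
        have : Continuous fun s : ℝ => y j + s * γ j := by fun_prop
        simpa using (this.tendsto 0).mono_left nhdsWithin_le_nhds
      filter_upwards [this.eventually (lt_mem_nhds h)] with s hs using hs.le
  obtain ⟨s, hs1, hs⟩ := (h1.and self_mem_nhdsWithin).exists
  have hs : 0 < s := hs
  have h2 := hmin (y + s • γ) (fun j => by simpa using hs1 j) (by simp [hγ])
  simp only [Pi.add_apply, Pi.smul_apply, smul_eq_mul, mul_add, Finset.sum_add_distrib,
    mul_left_comm _ s, ← Finset.mul_sum] at h2
  exact nonneg_of_mul_nonneg_right (a := s) (by linarith) hs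

/-- If the costs are generic, a minimal solution whose support spans gives an optimal basis. -/
theorem isOptimalBasis_of_min
    (hgen : ∀ S : Finset ι, (∃ γ ≠ 0, (∀ j ∉ S, γ j = 0) ∧ L γ = 0) →
      ∃ γ : ι → ℝ, (∀ j ∉ S, γ j = 0) ∧ L γ = 0 ∧ ∑ j, c j * γ j ≠ 0)
    {y : ι → ℝ} (hy : ∀ j, 0 ≤ y j)
    (hmin : ∀ z : ι → ℝ, (∀ j, 0 ≤ z j) → L z = L y → ∑ j, c j * y j ≤ ∑ j, c j * z j)
    (hB : ∀ j, j ∈ B ↔ y j ≠ 0)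
    (hspan : ∀ x, ∃ γ : ι → ℝ, (∀ j ∉ B, γ j = 0) ∧ L γ = L x) :
    IsOptimalBasis L c B := by
  have hzero : ∀ γ : ι → ℝ, (∀ j ∉ B, γ j = 0) → L γ = 0 → ∑ j, c j * γ j = 0 := by
    intro γ hγ h0
    have h1 := cost_nonneg_of_min hy hmin h0
      (fun j hj => (hγ j (by simp [hB, hj])).ge)
    have h2 := cost_nonneg_of_min (γ := -γ) hy hmin (by simp [h0])
      (fun j hj => by simp [hγ j (by simp [hB, hj])])
    simp only [Pi.neg_apply, mul_neg, Finset.sum_neg_distrib] at h2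
    linarith
  have hind : ∀ γ : ι → ℝ, (∀ j ∉ B, γ j = 0) → L γ = 0 → γ = 0 := by
    intro γ hγ h0
    by_contra hne
    obtain ⟨δ, h1, h2, h3⟩ := hgen B ⟨γ, hne, hγ, h0⟩
    exact h3 (hzero δ h1 h2)
  -- the reduced cost of an index outside `B` is positive
  have hred : ∀ j ∉ B, ∀ a : ι → ℝ, (∀ i ∉ B, a i = 0) → L a = L (Pi.single j 1) →
      0 < c j - ∑ i, c i * a i := by
    intro j hj a ha hLa
    have hval : ∑ i, c i * (Pi.single j 1 - a : ι → ℝ) i = c j - ∑ i, c i * a i := by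
      simp [mul_sub, Finset.sum_sub_distrib, Pi.single_apply]
    have hker : L (Pi.single j 1 - a) = 0 := by simp [hLa]
    have hge := cost_nonneg_of_min (γ := Pi.single j 1 - a) hy hmin hker (fun i hi => by
      have : a i = 0 := ha i (by simp [hB, hi])
      simp only [Pi.sub_apply, this, sub_zero, Pi.single_apply]
      split_ifs <;> simp)
    rw [hval] at hge
    refine lt_of_le_of_ne hge fun h0 => ?_
    have haj : a j = 0 := ha j hj
    obtain ⟨δ, h1, h2, h3⟩ := hgen (insert j B) ⟨Pi.single j 1 - a, fun h => by
        have := congrFun h j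
        simp [haj] at this, fun i hi => by
        rw [Finset.mem_insert, not_or] at hi
        simp [ha i hi.2, hi.1], hker⟩
    have : δ = δ j • (Pi.single j 1 - a) := sub_eq_zero.1 <| hind _ (fun i hi => by
        by_cases hij : i = j
        · subst hij; simp [haj]
        · simp [ha i hi, hij, h1 i (by simp [hi, hij])]) (by simp [h2, hLa])
    apply h3
    rw [this]
    simp only [Pi.smul_apply, smul_eq_mul, mul_left_comm _ (δ j), ← Finset.mul_sum, hval, ← h0,
      mul_zero]
  refine ⟨hspan, fun γ h0 hnn hne => ?_⟩
  choose a ha hLa using fun j => hspan (Pi.single j 1)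
  set b : ι → ℝ := ∑ j ∈ Bᶜ, γ j • (Pi.single j 1 - a j) with hb
  have hγb : γ = b := by
    have hsum : ∀ i, b i = ∑ j ∈ Bᶜ, γ j * ((Pi.single j 1 : ι → ℝ) i - a j i) := fun i => by
      simp [hb]
    refine sub_eq_zero.1 (hind _ (fun i hi => ?_) ?_)
    · have : ∀ j, a j i = 0 := fun j => ha j i hi
      rw [Pi.sub_apply, hsum, Finset.sum_eq_single i]
      · simp [this]
      · intro j _ hj
        simp [this, hj.symm]
      · simp [hi]
    · simp [hb, h0, hLa]
  have hcost : ∑ i, c i * γ i = ∑ j ∈ Bᶜ, γ j * (c j - ∑ i, c i * a j i) := by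
    conv_lhs => rw [hγb]
    simp only [hb, Finset.sum_apply, Pi.smul_apply, Pi.sub_apply, smul_eq_mul, Finset.mul_sum]
    rw [Finset.sum_comm]
    refine Finset.sum_congr rfl fun j _ => ?_
    simp only [mul_left_comm _ (γ j), ← Finset.mul_sum, mul_sub, Finset.sum_sub_distrib]
    simp [Pi.single_apply]
  rw [hcost]
  have hex : ∃ j ∈ Bᶜ, γ j ≠ 0 := by
    by_contra! hcon
    exact hne (hind γ (fun j hj => hcon j (by simpa using hj)) h0)
  obtain ⟨j, hj, hjne⟩ := hex
  have hpos : ∀ j ∈ Bᶜ, 0 < c j - ∑ i, c i * a j i := fun j hj =>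
    hred j (by simpa using hj) (a j) (ha j) (hLa j)
  refine Finset.sum_pos' (fun j hj => mul_nonneg (hnn j (by simpa using hj)) (hpos j hj).le)
    ⟨j, hj, mul_pos (lt_of_le_of_ne (hnn j (by simpa using hj)) hjne.symm) (hpos j hj)⟩

end LinearProgram

/-- Coefficient vectors of the points of a half-open simplicial cone with generators indexed by
`B`, the facets opposite to the generators in `O` being removed. -/
def IsHalfOpen {ι : Type*} (B O : Finset ι) (y : ι → ℝ) : Prop :=
  (∀ j ∉ B, y j = 0) ∧ ∀ j ∈ B, 0 ≤ y j ∧ (j ∈ O → 0 < y j)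

theorem map_eq_sum_mul {ι : Type*} [Fintype ι] (f : (ι → ℝ) →ₗ[ℝ] ℝ) (x : ι → ℝ) :
    f x = ∑ j, x j * f (Pi.single j 1) := by
  conv_lhs => rw [← Finset.univ_sum_single x, map_sum]
  refine Finset.sum_congr rfl fun j _ => ?_
  rw [← smul_eq_mul, ← map_smul, ← Pi.single_smul, smul_eq_mul, mul_one]

theorem eventually_add_mul_pos {ι : Type*} [Fintype ι] {B : Finset ι} {y κ : ι → ℝ}
    (hy : ∀ j ∈ B, 0 ≤ y j) (hκ : ∀ j ∈ B, y j = 0 → 0 < κ j) :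
    ∀ᶠ s : ℝ in nhdsWithin 0 (Set.Ioi 0), ∀ j ∈ B, 0 < y j + s * κ j := by
  refine (Filter.eventually_all_finset B).2 fun j hj => ?_
  rcases (hy j hj).eq_or_lt with h | h
  · filter_upwards [self_mem_nhdsWithin] with s hs
    rw [← h, zero_add]
    exact mul_pos hs (hκ j hj h.symm)
  · have : Tendsto (fun s : ℝ => y j + s * κ j) (nhdsWithin 0 (Set.Ioi 0)) (nhds (y j)) := by
      have : Continuous fun s : ℝ => y j + s * κ j := by fun_prop
      simpa using (this.tendsto 0).mono_left nhdsWithin_le_nhds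
    exact this.eventually (lt_mem_nhds h)

/-- A finitely generated cone is a disjoint union of half-open simplicial cones spanned by
generators. -/
theorem exists_halfOpen_decomposition {ι E : Type*} [Fintype ι] [AddCommGroup E] [Module ℝ E]
    (L : (ι → ℝ) →ₗ[ℝ] E) :
    ∃ (T : Finset (Finset ι)) (O : Finset ι → Finset ι),
      (∀ B ∈ T, ∀ γ : ι → ℝ, (∀ j ∉ B, γ j = 0) → L γ = 0 → γ = 0) ∧
      (∀ B ∈ T, ∀ φ : E →ₗ[ℝ] ℝ, (∀ j, 0 ≤ φ (L (Pi.single j 1))) →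
        (∃ j, 0 < φ (L (Pi.single j 1))) → ∃ b ∈ B, b ∉ O B ∧ 0 < φ (L (Pi.single b 1))) ∧
      (∀ x : ι → ℝ, (∀ j, 0 ≤ x j) → ∃ B ∈ T, ∃ y, IsHalfOpen B (O B) y ∧ L y = L x) ∧
      (∀ B ∈ T, ∀ B' ∈ T, ∀ y y', IsHalfOpen B (O B) y → IsHalfOpen B' (O B') y' →
        L y = L y' → B = B') := by
  obtain ⟨c, hc, hgen⟩ : ∃ c : ι → ℝ, (∀ j, 0 < c j) ∧
      ∀ S : Finset ι, (∃ γ ≠ 0, (∀ j ∉ S, γ j = 0) ∧ L γ = 0) →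
        ∃ γ : ι → ℝ, (∀ j ∉ S, γ j = 0) ∧ L γ = 0 ∧ ∑ j, c j * γ j ≠ 0 := by
    set P : Finset ι → Prop := fun S => ∃ γ ≠ 0, (∀ j ∉ S, γ j = 0) ∧ L γ = 0
    have hP : ∀ S, P S → ∃ γ ≠ 0, (∀ j ∉ S, γ j = 0) ∧ L γ = 0 := fun _ h => h
    choose! f hf using hP
    obtain ⟨c, hc, h⟩ := exists_pos_forall_sum_mul_ne_zero ((Finset.univ.filter P).image f) (by
      intro γ hγ
      obtain ⟨S, hS, rfl⟩ := Finset.mem_image.1 hγ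
      exact (hf S (Finset.mem_filter.1 hS).2).1)
    exact ⟨c, hc, fun S hS => ⟨f S, (hf S hS).2.1, (hf S hS).2.2,
      h _ (Finset.mem_image_of_mem _ (by simpa using hS))⟩⟩
  obtain ⟨q, hq, hqgen⟩ : ∃ q : ι → ℝ, (∀ j, 0 < q j) ∧
      ∀ S : Finset ι, (∃ x, ∀ γ : ι → ℝ, (∀ j ∉ S, γ j = 0) → L γ ≠ L x) →
        ∀ γ : ι → ℝ, (∀ j ∉ S, γ j = 0) → L γ ≠ L q := by
    set P : Finset ι → Prop := fun S => ∃ x, ∀ γ : ι → ℝ, (∀ j ∉ S, γ j = 0) → L γ ≠ L x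
    have hP : ∀ S, P S → ∃ f : (ι → ℝ) →ₗ[ℝ] ℝ, f ≠ 0 ∧
        ∀ γ x : ι → ℝ, (∀ j ∉ S, γ j = 0) → L γ = L x → f x = 0 := by
      rintro S ⟨x, hx⟩
      set p : Submodule ℝ (ι → ℝ) := ⨅ j ∈ {j | j ∉ S}, LinearMap.ker (LinearMap.proj j) with hp
      have hmem : ∀ γ, γ ∈ p ↔ ∀ j ∉ S, γ j = 0 := fun γ => by simp [hp]
      have hn : L x ∉ p.map L := by
        rintro ⟨γ, hγ, h⟩
        exact hx γ ((hmem γ).1 hγ) h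
      obtain ⟨f, hf, hle⟩ := Submodule.exists_le_ker_of_notMem hn
      refine ⟨f ∘ₗ L, fun h => hf (by simpa using LinearMap.congr_fun h x), fun γ z hγ hz => ?_⟩
      have := hle ⟨γ, (hmem γ).2 hγ, hz⟩
      simpa using this
    choose! f hf using hP
    obtain ⟨q, hq, h⟩ := exists_pos_forall_sum_mul_ne_zero
      ((Finset.univ.filter P).image fun S j => f S (Pi.single j 1)) (by
        intro γ hγ
        obtain ⟨S, hS, rfl⟩ := Finset.mem_image.1 hγ
        intro h0
        refine (hf S (Finset.mem_filter.1 hS).2).1 (LinearMap.ext fun x => ?_)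
        rw [map_eq_sum_mul]
        exact Finset.sum_eq_zero fun j _ => by rw [congrFun h0 j]; simp)
    refine ⟨q, hq, fun S hS γ hγ hLq => ?_⟩
    refine h _ (Finset.mem_image_of_mem _ (Finset.mem_filter.2 ⟨Finset.mem_univ S, hS⟩)) ?_
    rw [← map_eq_sum_mul]
    exact (hf S hS).2 γ q hγ hLq
  set T : Finset (Finset ι) := Finset.univ.filter (IsOptimalBasis L c) with hT
  have hTmem : ∀ B, B ∈ T ↔ IsOptimalBasis L c B := fun B => by simp [hT]
  have hκex : ∀ B, B ∈ T → ∃ κ : ι → ℝ, (∀ j ∉ B, κ j = 0) ∧ L κ = L q := fun B hB =>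
    ((hTmem B).1 hB).exists_eq q
  choose! κ hκ hLκ using hκex
  have hκne : ∀ B ∈ T, ∀ b ∈ B, κ B b ≠ 0 := by
    intro B hB b hb h0
    refine hqgen (B.erase b) ⟨Pi.single b 1, fun γ hγ hL => ?_⟩ (κ B) (fun j hj => ?_) (hLκ B hB)
    · have := ((hTmem B).1 hB).eq_of_map_eq (fun j hj => hγ j (by simp [hj]))
        (fun j hj => Pi.single_eq_of_ne (by rintro rfl; exact hj hb) _) hL
      have h1 := congrFun this b
      rw [hγ b (by simp), Pi.single_eq_same] at h1
      exact zero_ne_one h1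
    · by_cases hjb : j = b
      · rw [hjb, h0]
      · exact hκ B hB j fun h => hj (Finset.mem_erase.2 ⟨hjb, h⟩)
  set O : Finset ι → Finset ι := fun B => Finset.univ.filter fun b => κ B b < 0 with hO
  have hOmem : ∀ B b, b ∈ O B ↔ κ B b < 0 := fun B b => by simp [hO]
  refine ⟨T, O, fun B hB γ => ((hTmem B).1 hB).eq_zero, ?_, ?_, ?_⟩
  · intro B hB φ hφ ⟨j, hj⟩
    by_contra! hcon
    have h1 : 0 < φ (L q) := by
      rw [← LinearMap.comp_apply, map_eq_sum_mul]
      exact Finset.sum_pos' (fun i _ => mul_nonneg (hq i).le (hφ i))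
        ⟨j, Finset.mem_univ _, mul_pos (hq j) hj⟩
    refine absurd h1 (not_lt.2 ?_)
    rw [← hLκ B hB, ← LinearMap.comp_apply, map_eq_sum_mul]
    refine Finset.sum_nonpos fun i _ => ?_
    by_cases hi : i ∈ B
    · by_cases hi' : i ∈ O B
      · exact mul_nonpos_of_nonpos_of_nonneg ((hOmem B i).1 hi').le (hφ i)
      · have : φ (L (Pi.single i 1)) = 0 := le_antisymm (hcon i hi hi') (hφ i)
        simp [this]
    · simp [hκ B hB i hi]
  · intro x hx
    have hev : ∀ᶠ s : ℝ in nhdsWithin 0 (Set.Ioi 0), ∃ B ∈ T, ∃ y : ι → ℝ,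
        (∀ j ∉ B, y j = 0) ∧ (∀ j ∈ B, 0 < y j) ∧ L y = L (x + s • q) := by
      have hfin : ∀ᶠ s : ℝ in nhdsWithin 0 (Set.Ioi 0), ∀ S : Finset ι,
          (∃ γ : ι → ℝ, (∀ j ∉ S, γ j = 0) ∧ L γ = L (x + s • q)) →
            ∀ x, ∃ γ : ι → ℝ, (∀ j ∉ S, γ j = 0) ∧ L γ = L x := by
        refine Filter.eventually_all.2 fun S => ?_
        by_cases hS : ∀ x, ∃ γ : ι → ℝ, (∀ j ∉ S, γ j = 0) ∧ L γ = L x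
        · exact Filter.Eventually.of_forall fun _ _ => hS
        push Not at hS
        have hsub : {s : ℝ | ∃ γ : ι → ℝ, (∀ j ∉ S, γ j = 0) ∧ L γ = L (x + s • q)}.Subsingleton := by
          rintro s ⟨γ, hγ, h⟩ s' ⟨γ', hγ', h'⟩
          by_contra hne
          refine hqgen S hS ((s - s')⁻¹ • (γ - γ')) (fun j hj => by simp [hγ j hj, hγ' j hj]) ?_
          rw [map_smul, map_sub, h, h', ← map_sub, ← map_smul]
          congr 1
          rw [add_sub_add_left_eq_sub, ← sub_smul, smul_smul, inv_mul_cancel₀ (sub_ne_zero.2 hne),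
            one_smul]
        have : ∀ᶠ s : ℝ in nhdsWithin 0 (Set.Ioi 0),
            s ∉ {s : ℝ | ∃ γ : ι → ℝ, (∀ j ∉ S, γ j = 0) ∧ L γ = L (x + s • q)} \ {0} := by
          refine mem_nhdsWithin_of_mem_nhds
            ((hsub.finite.subset Set.sdiff_subset).isClosed.isOpen_compl.mem_nhds (by simp))
        filter_upwards [this, self_mem_nhdsWithin] with s hs hs0 hex
        exact absurd ⟨hex, ne_of_gt hs0⟩ hs
      filter_upwards [hfin, self_mem_nhdsWithin] with s hs hs0
      have hs0 : 0 < s := hs0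
      obtain ⟨y, hy, hLy, hmin⟩ := exists_min_cost L hc (x + s • q)
        (fun j => by simpa using add_nonneg (hx j) (mul_nonneg hs0.le (hq j).le))
      have hsupp : ∀ j ∉ Finset.univ.filter (fun j => y j ≠ 0), y j = 0 := fun j hj => by
        simpa using hj
      refine ⟨Finset.univ.filter fun j => y j ≠ 0, (hTmem _).2 ?_, y, hsupp, fun j hj => ?_, hLy⟩
      · exact isOptimalBasis_of_min hgen hy (fun z hz h => hmin z hz (h.trans hLy)) (by simp)
          (hs _ ⟨y, hsupp, hLy⟩)
      · exact lt_of_le_of_ne (hy j) (Finset.mem_filter.1 hj).2.symm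
    obtain ⟨B, hB, hfreq⟩ : ∃ B ∈ T, ∃ᶠ s : ℝ in nhdsWithin 0 (Set.Ioi 0), ∃ y : ι → ℝ,
        (∀ j ∉ B, y j = 0) ∧ (∀ j ∈ B, 0 < y j) ∧ L y = L (x + s • q) := by
      by_contra! hcon
      obtain ⟨s, ⟨B, hB, y, h1, h2, h3⟩, hs⟩ := (hev.and ((Filter.eventually_all_finset T).2 hcon)).exists
      exact hs B hB y h1 h2 h3
    have hopt := (hTmem B).1 hB
    obtain ⟨y, hy, hLy⟩ := hopt.exists_eq x
    have hfreq' : ∃ᶠ s : ℝ in nhdsWithin 0 (Set.Ioi 0), ∀ j ∈ B, 0 < y j + s * κ B j := by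
      refine hfreq.mono fun s ⟨z, hz, hpos, hLz⟩ j hj => ?_
      have : z = y + s • κ B := hopt.eq_of_map_eq hz
        (fun i hi => by simp [hy i hi, hκ B hB i hi]) (by simp [hLz, hLy, hLκ B hB])
      simpa [this] using hpos j hj
    have hnn : ∀ j ∈ B, 0 ≤ y j := by
      intro j hj
      by_contra! hneg
      have : Tendsto (fun s : ℝ => y j + s * κ B j) (nhdsWithin 0 (Set.Ioi 0)) (nhds (y j)) := by
        have : Continuous fun s : ℝ => y j + s * κ B j := by fun_prop
        simpa using (this.tendsto 0).mono_left nhdsWithin_le_nhds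
      obtain ⟨s, h1, h2⟩ := (hfreq'.and_eventually (this.eventually (gt_mem_nhds hneg))).exists
      exact lt_asymm (h1 j hj) h2
    refine ⟨B, hB, y, ⟨hy, fun j hj => ⟨hnn j hj, fun hjO => ?_⟩⟩, hLy⟩
    refine lt_of_le_of_ne (hnn j hj) fun h0 => ?_
    obtain ⟨s, h1, h2⟩ := (hfreq'.and_eventually self_mem_nhdsWithin).exists
    have h3 := h1 j hj
    rw [← h0, zero_add] at h3
    exact absurd h3 (not_lt.2 (mul_nonpos_of_nonneg_of_nonpos (le_of_lt h2)
      ((hOmem B j).1 hjO).le))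
  · intro B hB B' hB' y y' hy hy' hL
    have key : ∀ B ∈ T, ∀ y, IsHalfOpen B (O B) y →
        ∀ᶠ s : ℝ in nhdsWithin 0 (Set.Ioi 0), ∀ j ∈ B, 0 < y j + s * κ B j := by
      intro B hB y hy
      refine eventually_add_mul_pos (fun j hj => (hy.2 j hj).1) fun j hj h0 => ?_
      have h1 : j ∉ O B := fun h => ((hy.2 j hj).2 h).ne' h0
      rw [hOmem, not_lt] at h1
      exact lt_of_le_of_ne h1 (hκne B hB j hj).symm
    obtain ⟨s, h1, h2⟩ := ((key B hB y hy).and (key B' hB' y' hy')).exists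
    refine ((hTmem B).1 hB).unique ((hTmem B').1 hB') (γ := y + s • κ B) (γ' := y' + s • κ B')
      (fun j hj => ?_) (fun j hj => ?_) (fun j hj => by simpa using h1 j hj)
      (fun j hj => by simpa using h2 j hj) ?_
    · simp [hy.1 j hj, hκ B hB j hj]
    · simp [hy'.1 j hj, hκ B' hB' j hj]
    · simp [hL, hLκ B hB, hLκ B' hB']

theorem exists_polynomial_card_piAntidiag {ι : Type*} (s : Finset ι) {a : ℕ} (ha : a < s.card) :
    ∃ p : Polynomial ℝ, p.natDegree ≤ s.card - 1 ∧ ∀ n : ℕ,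
      p.eval (n : ℝ) = ((if a ≤ n then s.piAntidiag (n - a) else ∅ : Finset (ι → ℕ)).card : ℝ) := by
  refine ⟨Polynomial.preHilbertPoly ℝ (s.card - 1) a,
    (Polynomial.natDegree_preHilbertPoly ℝ _ _).le, fun n => ?_⟩
  split_ifs with h
  · have h1 : (s.piAntidiag (n - a)).card = (s.finsuppAntidiag (n - a)).card := by
      simp [Finset.finsuppAntidiag]
    rw [Polynomial.preHilbertPoly_eq_choose_sub_add ℝ _ h, h1,
      Finset.card_finsuppAntidiag_nat_eq_choose, show s.card + (n - a) - 1 = n - a + (s.card - 1) by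
        omega, ← Nat.choose_symm_add]
  · have h2 : (n : ℝ) - a + 1 = -((a - n - 1 : ℕ) : ℝ) := by
      rw [Nat.cast_sub (by omega), Nat.cast_sub (by omega)]
      push_cast; ring
    simp only [Polynomial.preHilbertPoly, Polynomial.eval_smul, Polynomial.eval_comp,
      Polynomial.eval_add, Polynomial.eval_sub, Polynomial.eval_X, Polynomial.eval_C,
      Polynomial.eval_one, h2]
    rw [ascPochhammer_eval_neg_coe_nat_of_lt (by omega)]
    simp

theorem degreeOf_aeval_X_le {σ : Type*} (p : Polynomial ℝ) (i j : σ) :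
    (Polynomial.aeval (MvPolynomial.X i : MvPolynomial σ ℝ) p).degreeOf j ≤
      if j = i then p.natDegree else 0 := by
  rw [Polynomial.aeval_eq_sum_range]
  refine (MvPolynomial.degreeOf_sum_le _ _ _).trans (Finset.sup_le fun m hm => ?_)
  rw [MvPolynomial.smul_eq_C_mul]
  refine (MvPolynomial.degreeOf_C_mul_le _ _ _).trans ((MvPolynomial.degreeOf_pow_le _ _ _).trans ?_)
  rw [MvPolynomial.degreeOf_X]
  split_ifs
  · simpa using Nat.lt_succ_iff.1 (Finset.mem_range.1 hm)
  · simp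

theorem totalDegree_aeval_X_le {σ : Type*} (p : Polynomial ℝ) (i : σ) :
    (Polynomial.aeval (MvPolynomial.X i : MvPolynomial σ ℝ) p).totalDegree ≤ p.natDegree := by
  rw [Polynomial.aeval_eq_sum_range]
  refine MvPolynomial.totalDegree_finsetSum_le fun m hm => ?_
  refine (MvPolynomial.totalDegree_smul_le _ _).trans ((MvPolynomial.totalDegree_pow _ _).trans ?_)
  rw [MvPolynomial.totalDegree_X, mul_one]
  exact Nat.lt_succ_iff.1 (Finset.mem_range.1 hm)

/-- A product of univariate polynomials in separate variables. -/
theorem exists_mvPolynomial_eval_eq_prod {σ : Type*} [Fintype σ] (p : σ → Polynomial ℝ) :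
    ∃ E : MvPolynomial σ ℝ, (∀ x : σ → ℝ, MvPolynomial.eval x E = ∏ i, (p i).eval (x i)) ∧
      (∀ i, E.degreeOf i ≤ (p i).natDegree) ∧ E.totalDegree ≤ ∑ i, (p i).natDegree := by
  refine ⟨∏ i, Polynomial.aeval (MvPolynomial.X i) (p i), fun x => ?_, fun i => ?_, ?_⟩
  · rw [map_prod]
    refine Finset.prod_congr rfl fun i _ => ?_
    rw [Polynomial.aeval_def, Polynomial.hom_eval₂, MvPolynomial.eval_X, Polynomial.eval]
    congr 1
    ext; simp
  · refine (MvPolynomial.degreeOf_prod_le _ _ _).trans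
      ((Finset.sum_le_sum fun j _ => degreeOf_aeval_X_le (p j) j i).trans ?_)
    simp
  · exact (MvPolynomial.totalDegree_finsetProd _ _).trans
      (Finset.sum_le_sum fun j _ => totalDegree_aeval_X_le (p j) j)

section Cayley

variable {d k : ℕ} {ι : Type*} [Fintype ι] (g : ι → Fin k) (v : ι → Fin d → ℤ)

/-- The linear map sending the `j`-th basis vector to the Cayley vector `(e_{g j}, v j)`. -/
noncomputable def cayleyMap : (ι → ℝ) →ₗ[ℝ] (Fin k → ℝ) × (Fin d → ℝ) :=
  (LinearMap.pi fun i => ∑ j with g j = i, LinearMap.proj j).prod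
    (LinearMap.pi fun l => ∑ j, (v j l : ℝ) • LinearMap.proj j)

theorem cayleyMap_fst (y : ι → ℝ) (i : Fin k) :
    (cayleyMap g v y).1 i = ∑ j with g j = i, y j := by
  simp [cayleyMap]

theorem cayleyMap_snd (y : ι → ℝ) (l : Fin d) :
    (cayleyMap g v y).2 l = ∑ j, (v j l : ℝ) * y j := by
  simp [cayleyMap]

theorem cayleyMap_eq_iff (y : ι → ℝ) (a : Fin k → ℝ) (u : Fin d → ℝ) :
    cayleyMap g v y = (a, u) ↔
      (∀ i, ∑ j with g j = i, y j = a i) ∧ ∀ l, ∑ j, (v j l : ℝ) * y j = u l := by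
  simp [Prod.ext_iff, funext_iff, cayleyMap_fst, cayleyMap_snd]

/-- Lattice vectors in the half-open fundamental parallelepiped, in coordinates. -/
def latticeBox (B O : Finset ι) : Set (ι → ℝ) :=
  {β | IsHalfOpen B O β ∧ (∀ j ∈ B, β j ≤ 1 ∧ (j ∉ O → β j < 1)) ∧
    ∃ (a : Fin k → ℕ) (u : Fin d → ℤ), cayleyMap g v β = (fun i => (a i : ℝ), fun l => (u l : ℝ))}

variable {g v} {B O : Finset ι}

theorem latticeBox_finite
    (hind : ∀ γ : ι → ℝ, (∀ j ∉ B, γ j = 0) → cayleyMap g v γ = 0 → γ = 0) :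
    (latticeBox g v B O).Finite := by
  have hinj : Set.InjOn (cayleyMap g v) (latticeBox g v B O) := by
    intro β hβ β' hβ' h
    refine sub_eq_zero.1 (hind _ (fun j hj => ?_) (by simp [h]))
    simp [hβ.1.1 j hj, hβ'.1.1 j hj]
  refine Set.Finite.of_finite_image (Set.Finite.subset (s := (fun p : (Fin k → ℕ) × (Fin d → ℤ) =>
      ((fun i => (p.1 i : ℝ), fun l => (p.2 l : ℝ)) : (Fin k → ℝ) × (Fin d → ℝ))) ''
      (Set.Iic (fun _ => Fintype.card ι) ×ˢ
        Set.Icc (fun l => -∑ j, |v j l|) (fun l => ∑ j, |v j l|))) ?_ ?_) hinj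
  · exact ((Set.finite_Iic _).prod (Set.finite_Icc _ _)).image _
  · rintro _ ⟨β, ⟨hβ, hβ1, a, u, hau⟩, rfl⟩
    refine ⟨(a, u), ?_, hau.symm⟩
    have hb : ∀ j, |β j| ≤ 1 := fun j => by
      by_cases hj : j ∈ B
      · rw [abs_of_nonneg (hβ.2 j hj).1]; exact (hβ1 j hj).1
      · simp [hβ.1 j hj]
    rw [cayleyMap_eq_iff] at hau
    have hu : ∀ l, |u l| ≤ ∑ j, |v j l| := fun l => by
      have : |(u l : ℝ)| ≤ ∑ j, |(v j l : ℝ)| := by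
        rw [← hau.2 l]
        refine (Finset.abs_sum_le_sum_abs _ _).trans (Finset.sum_le_sum fun j _ => ?_)
        rw [abs_mul]
        exact mul_le_of_le_one_right (abs_nonneg _) (hb j)
      exact_mod_cast this
    refine ⟨fun i => ?_, fun l => (abs_le.1 (hu l)).1, fun l => (abs_le.1 (hu l)).2⟩
    have : (a i : ℝ) ≤ Fintype.card ι := by
      rw [← hau.1 i]
      refine (Finset.sum_le_card_nsmul _ _ 1 fun j _ => (abs_le.1 (hb j)).2).trans ?_
      simpa using Finset.card_le_univ _
    exact_mod_cast this

theorem latticeBox_degree_lt (hO : ∀ i, ∃ b ∈ B, b ∉ O ∧ g b = i) {β : ι → ℝ}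
    (hβ : β ∈ latticeBox g v B O) (i : Fin k) {a : ℕ} (ha : ∑ j with g j = i, β j = a) :
    a < (B.filter (g · = i)).card := by
  obtain ⟨b, hb, hbO, rfl⟩ := hO i
  have h1 : ∑ j with g j = g b, β j = ∑ j ∈ B.filter (g · = g b), β j := by
    refine (Finset.sum_subset (fun j hj => by simpa using (Finset.mem_filter.1 hj).2)
      fun j hj hj' => ?_).symm
    exact hβ.1.1 j fun h => hj' (Finset.mem_filter.2 ⟨h, (Finset.mem_filter.1 hj).2⟩)
  have h2 : ∑ j ∈ B.filter (g · = g b), β j < ∑ j ∈ B.filter (g · = g b), (1 : ℝ) :=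
    Finset.sum_lt_sum (fun j hj => (hβ.2.1 j (Finset.mem_filter.1 hj).1).1)
      ⟨b, Finset.mem_filter.2 ⟨hb, rfl⟩, (hβ.2.1 b hb).2 hbO⟩
  rw [← h1, ha, Finset.sum_const, nsmul_eq_mul, mul_one] at h2
  exact_mod_cast h2

theorem latticeBox_add_injective {β β' : ι → ℝ} (hβ : β ∈ latticeBox g v B O)
    (hβ' : β' ∈ latticeBox g v B O) {m m' : ι → ℕ} (hm : ∀ j ∉ B, m j = 0)
    (hm' : ∀ j ∉ B, m' j = 0) (h : ∀ j, β j + m j = β' j + m' j) : β = β' ∧ m = m' := by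
  have key : m = m' := by
    funext j
    by_cases hj : j ∈ B
    · have h0 := hβ.1.2 j hj
      have h0' := hβ'.1.2 j hj
      have h1 := hβ.2.1 j hj
      have h1' := hβ'.2.1 j hj
      have hj' := h j
      have hlt : (m j : ℝ) < m' j + 1 ∧ (m' j : ℝ) < m j + 1 := by
        by_cases hjO : j ∈ O
        · have := h0.2 hjO
          have := h0'.2 hjO
          constructor <;> linarith
        · have := h1.2 hjO
          have := h1'.2 hjO
          constructor <;> linarith
      norm_cast at hlt
      omega
    · rw [hm j hj, hm' j hj]
  subst key
  exact ⟨funext fun j => by linarith [h j], rfl⟩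

theorem exists_latticeBox_add {y : ι → ℝ} (hy : IsHalfOpen B O y) {n : Fin k → ℕ}
    {z : Fin d → ℤ} (hL : cayleyMap g v y = (fun i => (n i : ℝ), fun l => (z l : ℝ))) :
    ∃ β ∈ latticeBox g v B O, ∃ m : ι → ℕ, (∀ j ∉ B, m j = 0) ∧ ∀ j, y j = β j + m j := by
  set m : ι → ℕ := fun j => if j ∈ O then ⌈y j⌉₊ - 1 else ⌊y j⌋₊ with hm
  have hmB : ∀ j ∉ B, m j = 0 := fun j hj => by simp [hm, hy.1 j hj]
  have h1 : ∀ j ∈ B, 0 ≤ y j - m j ∧ (j ∈ O → 0 < y j - m j) ∧ y j - m j ≤ 1 ∧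
      (j ∉ O → y j - m j < 1) := by
    intro j hj
    by_cases hjO : j ∈ O
    · have hpos := (hy.2 j hj).2 hjO
      have hc : 0 < ⌈y j⌉₊ := Nat.ceil_pos.2 hpos
      have hcast : (m j : ℝ) = ⌈y j⌉₊ - 1 := by
        simp only [hm, hjO, if_true]
        rw [Nat.cast_sub hc]; simp
      have h3 := Nat.le_ceil (y j)
      have h4 := Nat.ceil_lt_add_one hpos.le
      refine ⟨by linarith, fun _ => by linarith, by linarith, fun h => absurd hjO h⟩
    · have hnn := (hy.2 j hj).1
      have hcast : (m j : ℝ) = ⌊y j⌋₊ := by simp [hm, hjO]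
      have h3 := Nat.floor_le hnn
      have h4 := Nat.lt_floor_add_one (y j)
      refine ⟨by linarith, fun h => absurd h hjO, by linarith, fun _ => by linarith⟩
  have hnn : ∀ j, 0 ≤ y j - m j := fun j => by
    by_cases hj : j ∈ B
    · exact (h1 j hj).1
    · simp [hy.1 j hj, hmB j hj]
  rw [cayleyMap_eq_iff] at hL
  refine ⟨fun j => y j - m j, ⟨⟨fun j hj => by simp [hy.1 j hj, hmB j hj],
    fun j hj => ⟨(h1 j hj).1, (h1 j hj).2.1⟩⟩, fun j hj => (h1 j hj).2.2,
    fun i => n i - ∑ j with g j = i, m j, fun l => z l - ∑ j, v j l * m j, ?_⟩, m, hmB,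
    fun j => by ring⟩
  rw [cayleyMap_eq_iff]
  refine ⟨fun i => ?_, fun l => ?_⟩
  · have hle : ∑ j with g j = i, m j ≤ n i := by
      have : 0 ≤ ∑ j with g j = i, (y j - m j) := Finset.sum_nonneg fun j _ => hnn j
      rw [Finset.sum_sub_distrib, hL.1 i, sub_nonneg] at this
      exact_mod_cast this
    rw [Finset.sum_sub_distrib, hL.1 i, Nat.cast_sub hle]
    push_cast; rfl
  · simp only [mul_sub, Finset.sum_sub_distrib, hL.2 l]
    push_cast; rfl

/-- The lattice points of given multidegree in a half-open simplicial Cayley cone are counted by a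
polynomial. -/
theorem exists_mvPolynomial_halfOpen
    (hind : ∀ γ : ι → ℝ, (∀ j ∉ B, γ j = 0) → cayleyMap g v γ = 0 → γ = 0)
    (hO : ∀ i, ∃ b ∈ B, b ∉ O ∧ g b = i) :
    ∃ E : MvPolynomial (Fin k) ℝ,
      (∀ n : Fin k → ℕ, ∃ Z : Finset (Fin d → ℤ),
        (∀ z, z ∈ Z ↔ ∃ y, IsHalfOpen B O y ∧
          cayleyMap g v y = (fun i => (n i : ℝ), fun l => (z l : ℝ))) ∧
        MvPolynomial.eval (fun i => (n i : ℝ)) E = Z.card) ∧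
      (∀ i, E.degreeOf i ≤ (B.filter (g · = i)).card - 1) ∧
      E.totalDegree ≤ ∑ i, ((B.filter (g · = i)).card - 1) := by
  have hau : ∀ β, β ∈ latticeBox g v B O → ∃ (a : Fin k → ℕ) (u : Fin d → ℤ),
      cayleyMap g v β = (fun i => (a i : ℝ), fun l => (u l : ℝ)) := fun β hβ => hβ.2.2
  choose! a u hau using hau
  have hp : ∀ β i, ∃ p : Polynomial ℝ, β ∈ latticeBox g v B O →
      p.natDegree ≤ (B.filter (g · = i)).card - 1 ∧ ∀ n : ℕ, p.eval (n : ℝ) =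
        ((if a β i ≤ n then (B.filter (g · = i)).piAntidiag (n - a β i) else ∅ :
          Finset (ι → ℕ)).card : ℝ) := by
    intro β i
    by_cases hβ : β ∈ latticeBox g v B O
    · have hlt := latticeBox_degree_lt hO hβ i (((cayleyMap_eq_iff _ _ _ _ _).1 (hau β hβ)).1 i)
      obtain ⟨p, hp⟩ := exists_polynomial_card_piAntidiag _ hlt
      exact ⟨p, fun _ => hp⟩
    · exact ⟨0, fun h => absurd h hβ⟩
  choose p hp using hp
  choose E hE hEdeg hEtot using fun β => exists_mvPolynomial_eval_eq_prod (p β)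
  have hfin := latticeBox_finite (O := O) hind
  have hmem : ∀ β, β ∈ hfin.toFinset ↔ β ∈ latticeBox g v B O := fun β => hfin.mem_toFinset
  refine ⟨∑ β ∈ hfin.toFinset, E β, fun n => ?_, fun i => ?_, ?_⟩
  · set S : (ι → ℝ) → Finset (Fin k → ι → ℕ) := fun β => Fintype.piFinset fun i =>
      (if a β i ≤ n i then (B.filter (g · = i)).piAntidiag (n i - a β i) else ∅ :
          Finset (ι → ℕ)) with hS
    have hSmem : ∀ β f, f ∈ S β ↔ ∀ i, (a β i + ∑ j ∈ B.filter (g · = i), f i j = n i) ∧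
        ∀ j, f i j ≠ 0 → j ∈ B ∧ g j = i := by
      intro β f
      rw [hS, Fintype.mem_piFinset]
      refine forall_congr' fun i => ?_
      split_ifs with h
      · rw [Finset.mem_piAntidiag]
        refine and_congr ?_ (by simp)
        change ∑ j ∈ B.filter (g · = i), f i j = _ ↔ _
        omega
      · simp only [Finset.notMem_empty, false_iff, not_and]
        intro h'; omega
    set φ : (Σ _ : ι → ℝ, Fin k → ι → ℕ) → Fin d → ℤ :=
      fun x l => u x.1 l + ∑ j, v j l * x.2 (g j) j with hφ
    have hy : ∀ x ∈ hfin.toFinset.sigma S,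
        (∀ j ∉ B, x.2 (g j) j = 0) ∧ IsHalfOpen B O (fun j => x.1 j + x.2 (g j) j) ∧
        cayleyMap g v (fun j => x.1 j + x.2 (g j) j) =
          (fun i => (n i : ℝ), fun l => (φ x l : ℝ)) := by
      rintro ⟨β, f⟩ hx
      rw [Finset.mem_sigma, hmem] at hx
      obtain ⟨hβ, hf⟩ := hx
      dsimp only at hβ hf
      rw [hSmem] at hf
      have hfB : ∀ j ∉ B, f (g j) j = 0 := fun j hj => by
        by_contra hne
        exact hj ((hf _).2 j hne).1
      have haub := (cayleyMap_eq_iff _ _ _ _ _).1 (hau β hβ)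
      refine ⟨hfB, ⟨fun j hj => ?_, fun j hj => ⟨?_, fun hjO => ?_⟩⟩, ?_⟩
      · simp [hβ.1.1 j hj, hfB j hj]
      · exact add_nonneg (hβ.1.2 j hj).1 (Nat.cast_nonneg _)
      · exact add_pos_of_pos_of_nonneg ((hβ.1.2 j hj).2 hjO) (Nat.cast_nonneg _)
      · rw [cayleyMap_eq_iff]
        refine ⟨fun i => ?_, fun l => ?_⟩
        · have : ∑ j with g j = i, f (g j) j = ∑ j ∈ B.filter (g · = i), f i j := by
            symm
            refine Finset.sum_subset_zero_on_sdiff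
              (fun j hj => by simpa using (Finset.mem_filter.1 hj).2) (fun j hj => ?_)
              fun j hj => by rw [(Finset.mem_filter.1 hj).2]
            simp only [Finset.mem_sdiff, Finset.mem_filter, Finset.mem_univ, true_and] at hj
            exact hfB j fun h => hj.2 ⟨h, hj.1⟩
          rw [Finset.sum_add_distrib, haub.1 i, ← (hf i).1, ← this]
          push_cast; rfl
        · simp only [mul_add, Finset.sum_add_distrib, haub.2 l, hφ]
          push_cast; rfl
    have hinj : Set.InjOn φ (hfin.toFinset.sigma S) := by
      rintro ⟨β, f⟩ hx ⟨β', f'⟩ hx' h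
      obtain ⟨h1, h2, h3⟩ := hy _ hx
      obtain ⟨h1', h2', h3'⟩ := hy _ hx'
      rw [h, ← h3'] at h3
      have heq : (fun j => β j + f (g j) j : ι → ℝ) = fun j => β' j + f' (g j) j := by
        refine sub_eq_zero.1 (hind _ (fun j hj => ?_) (by rw [map_sub]; exact sub_eq_zero.2 h3))
        exact sub_eq_zero.2 ((h2.1 j hj).trans (h2'.1 j hj).symm)
      simp only [Finset.mem_coe, Finset.mem_sigma, hmem] at hx hx'
      obtain ⟨rfl, hff⟩ := latticeBox_add_injective hx.1 hx'.1 h1 h1' fun j => congrFun heq j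
      have hf := (hSmem _ _).1 hx.2
      have hf' := (hSmem _ _).1 hx'.2
      congr 1
      funext i j
      by_cases hj : g j = i
      · subst hj; exact congrFun hff j
      · have e1 : f i j = 0 := by
          by_contra hne
          exact hj ((hf i).2 j hne).2
        have e2 : f' i j = 0 := by
          by_contra hne
          exact hj ((hf' i).2 j hne).2
        rw [e1, e2]
    refine ⟨(hfin.toFinset.sigma S).image φ, fun z => ⟨fun hz => ?_, ?_⟩, ?_⟩
    · obtain ⟨x, hx, rfl⟩ := Finset.mem_image.1 hz
      exact ⟨_, (hy x hx).2⟩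
    · rintro ⟨y, hyo, hLy⟩
      obtain ⟨β, hβ, m, hm, hym⟩ := exists_latticeBox_add hyo hLy
      have haub := (cayleyMap_eq_iff _ _ _ _ _).1 (hau β hβ)
      have hLy' := (cayleyMap_eq_iff _ _ _ _ _).1 hLy
      refine Finset.mem_image.2 ⟨⟨β, fun i j => if g j = i then m j else 0⟩, ?_, ?_⟩
      · rw [Finset.mem_sigma, hmem]
        refine ⟨hβ, (hSmem _ _).2 fun i => ⟨?_, fun j hj => ?_⟩⟩
        · have h1 := hLy'.1 i
          simp only [hym, Finset.sum_add_distrib, haub.1 i] at h1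
          norm_cast at h1
          rw [← h1]
          congr 1
          refine Finset.sum_subset_zero_on_sdiff
            (fun j hj => by simpa using (Finset.mem_filter.1 hj).2) (fun j hj => ?_)
            fun j hj => by simp [(Finset.mem_filter.1 hj).2]
          simp only [Finset.mem_sdiff, Finset.mem_filter, Finset.mem_univ, true_and] at hj
          exact hm j fun h => hj.2 ⟨h, hj.1⟩
        · dsimp only at hj
          split_ifs at hj with h
          · exact ⟨by_contra fun h' => hj (hm j h'), h⟩
          · exact absurd rfl hj
      · funext l
        have h1 := hLy'.2 l
        simp only [hym, mul_add, Finset.sum_add_distrib, haub.2 l] at h1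
        simp only [hφ, if_true]
        exact_mod_cast h1
    · rw [Finset.card_image_of_injOn hinj, Finset.card_sigma, map_sum, Nat.cast_sum]
      refine Finset.sum_congr rfl fun β hβ => ?_
      rw [hE, hS, Fintype.card_piFinset, Nat.cast_prod]
      exact Finset.prod_congr rfl fun i _ => (hp β i ((hmem β).1 hβ)).2 (n i)
  · refine (MvPolynomial.degreeOf_sum_le _ _ _).trans (Finset.sup_le fun β hβ => ?_)
    exact (hEdeg β i).trans (hp β i ((hmem β).1 hβ)).1
  · refine MvPolynomial.totalDegree_finsetSum_le fun β hβ => ?_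
    exact (hEtot β).trans (Finset.sum_le_sum fun i _ => (hp β i ((hmem β).1 hβ)).1)

end Cayley

section UpperBound

variable {d k : ℕ} {ι : Type*} [Fintype ι] {g : ι → Fin k} {v : ι → Fin d → ℤ}

theorem cayleyMap_single (j : ι) :
    cayleyMap g v (Pi.single j 1) = (Pi.single (g j) 1, fun l => (v j l : ℝ)) := by
  rw [cayleyMap_eq_iff]
  refine ⟨fun i => ?_, fun l => by simp [Pi.single_apply]⟩
  rw [Finset.sum_filter, Pi.single_apply, Finset.sum_eq_single j]
  · simp [eq_comm]
  · intro b _ hb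
    simp [hb]
  · simp

theorem proj_cayleyMap_single (i : Fin k) (j : ι) :
    (LinearMap.proj i ∘ₗ LinearMap.fst ℝ (Fin k → ℝ) (Fin d → ℝ))
      (cayleyMap g v (Pi.single j 1)) = if g j = i then 1 else 0 := by
  rw [cayleyMap_single]
  simp [Pi.single_apply, eq_comm]

/-- Linearly independent Cayley vectors yield linearly independent edge directions. -/
theorem sum_card_sub_one_le_finrank {B : Finset ι}
    (hind : ∀ γ : ι → ℝ, (∀ j ∉ B, γ j = 0) → cayleyMap g v γ = 0 → γ = 0)
    {b : Fin k → ι} (hb : ∀ i, b i ∈ B) (hgb : ∀ i, g (b i) = i) (I : Finset (Fin k))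
    (W : Submodule ℝ (Fin d → ℝ))
    (hW : ∀ j ∈ B, g j ∈ I → (fun l => (v j l : ℝ) - v (b (g j)) l) ∈ W) :
    ∑ i ∈ I, ((B.filter (g · = i)).card - 1) ≤ Module.finrank ℝ W := by
  set D : Finset ι := B.filter fun j => g j ∈ I ∧ j ≠ b (g j) with hD
  have hcard : D.card = ∑ i ∈ I, ((B.filter (g · = i)).card - 1) := by
    rw [Finset.card_eq_sum_card_fiberwise (f := g) (t := I)
      (fun j hj => (Finset.mem_filter.1 hj).2.1)]
    refine Finset.sum_congr rfl fun i hi => ?_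
    rw [← Finset.card_erase_of_mem (a := b i) (by simp [hb, hgb])]
    congr 1
    ext j
    simp only [hD, Finset.mem_filter, Finset.mem_erase]
    constructor
    · rintro ⟨⟨h1, -, h2⟩, rfl⟩
      exact ⟨h2, h1, rfl⟩
    · rintro ⟨h1, h2, rfl⟩
      exact ⟨⟨h2, hi, h1⟩, rfl⟩
  rw [← hcard, ← Fintype.card_coe]
  have hmem : ∀ j : D, (fun l => (v j l : ℝ) - v (b (g j)) l) ∈ W := fun j =>
    hW j (Finset.mem_filter.1 j.2).1 (Finset.mem_filter.1 j.2).2.1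
  refine LinearIndependent.fintype_card_le_finrank (R := ℝ)
    (b := fun j : D => (⟨_, hmem j⟩ : W)) ?_
  rw [Fintype.linearIndependent_iff]
  intro c hc
  have hc' : ∀ l, ∑ j : D, c j * ((v j l : ℝ) - v (b (g j)) l) = 0 := fun l => by
    have := congrFun (congrArg Subtype.val hc) l
    simpa using this
  have h0 := hind (∑ j : D, c j • (Pi.single (j : ι) 1 - Pi.single (b (g j)) 1)) (fun i hi => by
      simp only [Finset.sum_apply, Pi.smul_apply, Pi.sub_apply, smul_eq_mul]
      refine Finset.sum_eq_zero fun j _ => ?_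
      have h1 : i ≠ j := by rintro rfl; exact hi (Finset.mem_filter.1 j.2).1
      have h2 : i ≠ b (g j) := by rintro rfl; exact hi (hb _)
      simp [h1, h2]) (by
      simp only [map_sum, map_smul, map_sub, cayleyMap_single, hgb]
      refine Prod.ext ?_ (funext fun l => ?_)
      · simp [Prod.fst_sum]
      · simpa [Prod.snd_sum] using hc' l)
  intro j
  have h1 := congrFun h0 j
  simp only [Finset.sum_apply, Pi.smul_apply, Pi.sub_apply, smul_eq_mul, Pi.zero_apply] at h1
  rw [Finset.sum_eq_single j] at h1
  · simpa [(Finset.mem_filter.1 j.2).2.2] using h1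
  · intro i _ hi
    have e1 : (j : ι) ≠ i := fun h => hi (Subtype.ext h).symm
    have e2 : (j : ι) ≠ b (g i) := fun h => by
      have h3 := (Finset.mem_filter.1 j.2).2.2
      rw [h, hgb] at h3
      exact h3 rfl
    simp [e1, e2]
  · simp

end UpperBound

section Polytope

variable {d k : ℕ}

theorem mem_convexHull_intCast_iff (V : Finset (Fin d → ℤ)) (p : Fin d → ℝ) :
    p ∈ convexHull ℝ ((fun z : Fin d → ℤ => fun i => (z i : ℝ)) '' ↑V) ↔
      ∃ w : V → ℝ, (∀ x, 0 ≤ w x) ∧ ∑ x, w x = 1 ∧ ∀ l, ∑ x : V, (x.1 l : ℝ) * w x = p l := by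
  have hinj : Function.Injective (fun z : Fin d → ℤ => fun i => (z i : ℝ)) := fun z z' h =>
    funext fun i => Int.cast_injective (α := ℝ) (congrFun h i)
  constructor
  · intro hp
    rw [← Finset.coe_image, Finset.mem_convexHull'] at hp
    obtain ⟨w, hw, hw1, hwp⟩ := hp
    rw [Finset.sum_image hinj.injOn] at hw1 hwp
    refine ⟨fun x => w fun i => (x.1 i : ℝ), fun x => hw _ (Finset.mem_image_of_mem _ x.2), ?_,
      fun l => ?_⟩
    · rw [← hw1, ← Finset.sum_coe_sort V]
    · rw [← hwp, ← Finset.sum_coe_sort V]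
      simp [mul_comm]
  · rintro ⟨w, hw, hw1, hwp⟩
    have : p = ∑ x : V, w x • fun i => (x.1 i : ℝ) := by
      funext l; rw [← hwp l]; simp [mul_comm]
    rw [this]
    exact (convex_convexHull ℝ _).sum_mem (fun x _ => hw x) hw1
      fun x _ => subset_convexHull ℝ _ ⟨x.1, x.2, rfl⟩

theorem sum_filter_fst_eq {α : Fin k → Type*} [∀ i, Fintype (α i)] (f : (Σ i, α i) → ℝ)
    (i : Fin k) : ∑ j with j.1 = i, f j = ∑ x, f ⟨i, x⟩ := by
  rw [Finset.sum_filter, Fintype.sum_sigma, Finset.sum_eq_single i]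
  · simp
  · intro i₁ _ hi₁
    simp [hi₁]
  · simp

/-- The Cayley trick: lattice dilates of a Minkowski sum are slices of the Cayley cone. -/
theorem mem_sum_smul_convexHull_iff (V : Fin k → Finset (Fin d → ℤ)) (hV : ∀ i, (V i).Nonempty)
    (n : Fin k → ℕ) (z : Fin d → ℝ) :
    z ∈ ∑ i, (n i : ℝ) • convexHull ℝ ((fun z : Fin d → ℤ => fun i => (z i : ℝ)) '' ↑(V i)) ↔
      ∃ x : (Σ i, V i) → ℝ, (∀ j, 0 ≤ x j) ∧
        cayleyMap (fun j : Σ i, V i => j.1) (fun j => j.2.1) x = (fun i => (n i : ℝ), z) := by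
  rw [Set.mem_fintype_sum]
  simp only [cayleyMap_eq_iff]
  constructor
  · rintro ⟨q, hq, rfl⟩
    have hq' : ∀ i, ∃ w : V i → ℝ, (∀ x, 0 ≤ w x) ∧ ∑ x, w x = 1 ∧
        ∀ l, ∑ x : V i, (x.1 l : ℝ) * (n i * w x) = q i l := by
      intro i
      obtain ⟨p, hp, hpq⟩ := Set.mem_smul_set.1 (hq i)
      obtain ⟨w, hw, hw1, hwp⟩ := (mem_convexHull_intCast_iff _ _).1 hp
      refine ⟨w, hw, hw1, fun l => ?_⟩
      simp only [mul_left_comm _ (n i : ℝ), ← Finset.mul_sum, hwp l, ← hpq]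
      rfl
    choose w hw hw1 hwq using hq'
    refine ⟨fun j => n j.1 * w j.1 j.2, fun j => mul_nonneg (Nat.cast_nonneg _) (hw _ _),
      fun i => ?_, fun l => ?_⟩
    · rw [sum_filter_fst_eq]
      dsimp only
      rw [← Finset.mul_sum, hw1, mul_one]
    · rw [Fintype.sum_sigma, Finset.sum_apply]
      exact Finset.sum_congr rfl fun i _ => hwq i l
  · rintro ⟨x, hx, hxn, hxz⟩
    refine ⟨fun i l => ∑ y : V i, (y.1 l : ℝ) * x ⟨i, y⟩, fun i => ?_, ?_⟩
    · have hsum : ∑ y, x ⟨i, y⟩ = n i := by rw [← hxn i, sum_filter_fst_eq]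
      rcases Nat.eq_zero_or_pos (n i) with h0 | hpos
      · rw [h0, Nat.cast_zero, Finset.sum_eq_zero_iff_of_nonneg (fun y _ => hx _)] at hsum
        obtain ⟨y, hy⟩ := hV i
        refine Set.mem_smul_set.2 ⟨_, subset_convexHull ℝ _ ⟨y, hy, rfl⟩, ?_⟩
        funext l
        rw [h0, Nat.cast_zero, zero_smul, Pi.zero_apply]
        exact (Finset.sum_eq_zero fun y hy => by rw [hsum y hy, mul_zero]).symm
      · have hne : (n i : ℝ) ≠ 0 := by positivity
        refine Set.mem_smul_set.2 ⟨fun l => ∑ y : V i, (y.1 l : ℝ) * (x ⟨i, y⟩ / n i),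
          (mem_convexHull_intCast_iff _ _).2 ⟨fun y => x ⟨i, y⟩ / n i,
            fun y => div_nonneg (hx _) (Nat.cast_nonneg _), ?_, fun l => rfl⟩, ?_⟩
        · rw [← Finset.sum_div, hsum, div_self hne]
        · funext l
          simp only [Pi.smul_apply, smul_eq_mul, Finset.mul_sum]
          refine Finset.sum_congr rfl fun y _ => ?_
          field_simp
    · funext l
      rw [← hxz l, Fintype.sum_sigma, Finset.sum_apply]

theorem IsLatticePolytope.nonempty {P : Set (Fin d → ℝ)} (hP : IsLatticePolytope P) :
    P.Nonempty := by
  obtain ⟨V, hV, rfl⟩ := hP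
  exact (hV.to_set.image _).convexHull

theorem IsLatticePolytope.convex {P : Set (Fin d → ℝ)} (hP : IsLatticePolytope P) :
    Convex ℝ P := by
  obtain ⟨V, hV, rfl⟩ := hP
  exact convex_convexHull ℝ _

theorem IsLatticePolytope.isBounded {P : Set (Fin d → ℝ)} (hP : IsLatticePolytope P) :
    Bornology.IsBounded P := by
  obtain ⟨V, hV, rfl⟩ := hP
  exact isBounded_convexHull.2 (V.finite_toSet.image _).isBounded

theorem IsLatticePolytope.sum {P : Fin k → Set (Fin d → ℝ)} (hP : ∀ i, IsLatticePolytope (P i)) :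
    IsLatticePolytope (∑ i, P i) := by
  choose V hV hPV using hP
  set f : (Fin d → ℤ) →+ (Fin d → ℝ) := (Int.castAddHom ℝ).compLeft (Fin d) with hf
  refine ⟨∑ i, V i, ?_, ?_⟩
  · choose p hp using hV
    refine ⟨∑ i, p i, ?_⟩
    rw [← Finset.mem_coe, Finset.coe_sum]
    exact Set.finsetSum_mem_finsetSum _ _ _ fun i _ => hp i
  · have h1 : (fun z : Fin d → ℤ => fun i => (z i : ℝ)) '' ↑(∑ i, V i) =
        ∑ i, (fun z : Fin d → ℤ => fun i => (z i : ℝ)) '' ↑(V i) := by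
      rw [Finset.coe_sum]
      exact Set.image_finsetSum f _ _
    rw [h1, convexHull_sum]
    exact Finset.sum_congr rfl fun i _ => hPV i

theorem finite_latticePoints {S : Set (Fin d → ℝ)} (hS : Bornology.IsBounded S) :
    {z : Fin d → ℤ | (fun i => (z i : ℝ)) ∈ S}.Finite := by
  obtain ⟨r, hr⟩ := hS.exists_norm_le
  refine (Set.finite_Icc (fun _ => -⌈r⌉) (fun _ => ⌈r⌉)).subset fun z hz => ?_
  have h : ∀ i, |z i| ≤ ⌈r⌉ := fun i => by
    have h1 := (norm_le_pi_norm (fun i => (z i : ℝ)) i).trans (hr _ hz)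
    rw [Real.norm_eq_abs] at h1
    have h2 := h1.trans (Int.le_ceil r)
    exact_mod_cast h2
  exact ⟨fun i => (abs_le.1 (h i)).1, fun i => (abs_le.1 (h i)).2⟩

/-- Dilates of a lattice polytope contain many lattice points. -/
theorem pow_le_latticePointCount {Q : Set (Fin d → ℝ)} (hQ : IsLatticePolytope Q) (m : ℕ) :
    (m + 1) ^ polytopeDim Q ≤ latticePointCount (((polytopeDim Q * m : ℕ) : ℝ) • Q) := by
  have hconv := hQ.convex
  have hbdd := hQ.isBounded
  have hne := hQ.nonempty
  obtain ⟨V, ⟨p, hp⟩, hQV⟩ := hQ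
  set ψ : (Fin d → ℤ) → Fin d → ℝ := fun z i => (z i : ℝ) with hψ
  have hsub : ∀ z ∈ V, ψ z ∈ Q := fun z hz => hQV ▸ subset_convexHull ℝ _ ⟨z, hz, rfl⟩
  obtain ⟨D, hD, f, hfV, hfind⟩ : ∃ D, polytopeDim Q = D ∧ ∃ f : Fin D → Fin d → ℤ,
      (∀ i, f i ∈ V) ∧ LinearIndependent ℝ fun i => ψ (f i) - ψ p := by
    have h1 : (affineSpan ℝ Q).direction =
        Submodule.span ℝ ((fun x => x -ᵥ ψ p) '' (ψ '' (V : Set (Fin d → ℤ)))) := by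
      rw [hQV, affineSpan_convexHull, direction_affineSpan,
        vectorSpan_eq_span_vsub_set_right ℝ
          (show ψ p ∈ ψ '' (V : Set (Fin d → ℤ)) from ⟨p, hp, rfl⟩)]
    obtain ⟨f, hf, -, hind⟩ := Submodule.exists_fun_fin_finrank_span_eq ℝ
      ((fun x => x -ᵥ ψ p) '' (ψ '' (V : Set (Fin d → ℤ))))
    have hf' : ∀ i, ∃ z ∈ V, ψ z - ψ p = f i := fun i => by
      obtain ⟨_, ⟨z, hz, rfl⟩, h⟩ := hf i
      exact ⟨z, hz, h⟩
    choose u hu huf using hf'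
    refine ⟨_, ?_, u, hu, ?_⟩
    · rw [polytopeDim, h1]
    · simpa only [huf] using hind
  rw [hD]
  set Φ : (Fin D → Fin (m + 1)) → Fin d → ℤ := fun μ l =>
    (D * m : ℕ) * p l + ∑ i, ((μ i : ℕ) : ℤ) * (f i l - p l) with hΦ
  have hΦψ : ∀ μ, ψ (Φ μ) = ((D * m : ℕ) : ℝ) • ψ p +
      ∑ i, ((μ i : ℕ) : ℝ) • (ψ (f i) - ψ p) := fun μ => by
    funext l
    simp [hψ, hΦ]
  have hinj : Function.Injective Φ := by
    intro μ μ' h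
    have h1 := (hΦψ μ).symm.trans ((congrArg ψ h).trans (hΦψ μ'))
    rw [add_right_inj, ← sub_eq_zero, ← Finset.sum_sub_distrib] at h1
    simp only [← sub_smul] at h1
    funext i
    have h2 := Fintype.linearIndependent_iff.1 hfind _ h1 i
    rw [sub_eq_zero, Nat.cast_inj] at h2
    exact Fin.ext h2
  have hmem : ∀ μ, ψ (Φ μ) ∈ ((D * m : ℕ) : ℝ) • Q := by
    intro μ
    rcases Nat.eq_zero_or_pos (D * m) with h0 | hpos
    · have h2 : ∀ i, (μ i : ℕ) = 0 := fun i => by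
        have hD0 : D ≠ 0 := (Fin.pos i).ne'
        have hm0 : m = 0 := by simpa [hD0] using h0
        have := (μ i).2
        omega
      rw [hΦψ, h0]
      simp [h2, Set.zero_smul_set hne]
    · have hDpos : 0 < D := Nat.pos_of_mul_pos_right hpos
      have hmpos : 0 < m := Nat.pos_of_mul_pos_left hpos
      refine Set.mem_smul_set.2 ⟨∑ i : Fin D, (D : ℝ)⁻¹ •
        (ψ p + ((μ i : ℕ) / m : ℝ) • (ψ (f i) - ψ p)), ?_, ?_⟩
      · refine hconv.sum_mem (fun _ _ => by positivity) (by simp [hDpos.ne']) fun i _ => ?_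
        refine hconv.add_smul_sub_mem (hsub p hp) (hsub _ (hfV i)) ⟨by positivity, ?_⟩
        rw [div_le_one (by positivity)]
        exact_mod_cast Nat.lt_succ_iff.1 (μ i).2
      · rw [hΦψ, ← Finset.smul_sum, Finset.sum_add_distrib, Finset.sum_const, Finset.card_univ,
          Fintype.card_fin, smul_smul, smul_add, Finset.smul_sum, ← Nat.cast_smul_eq_nsmul ℝ,
          smul_smul]
        have e : ((D * m : ℕ) : ℝ) * (D : ℝ)⁻¹ = m := by
          push_cast; field_simp
        rw [e]
        congr 1
        · congr 1; push_cast; ring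
        · refine Finset.sum_congr rfl fun i _ => ?_
          rw [smul_smul]
          congr 1
          field_simp
  calc (m + 1) ^ D = (Set.range Φ).ncard := by
        rw [← Set.image_univ, Set.ncard_image_of_injective _ hinj, Set.ncard_univ]
        simp
    _ ≤ _ := Set.ncard_le_ncard (by rintro _ ⟨μ, rfl⟩; exact hmem μ)
        (finite_latticePoints (hbdd.smul₀ _))

end Polytope

theorem le_natDegree_of_pow_le_eval {p : Polynomial ℝ} {D : ℕ}
    (h : ∀ m : ℕ, ((m : ℝ) + 1) ^ D ≤ p.eval (m : ℝ)) : D ≤ p.natDegree := by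
  by_contra! hlt
  have hdeg : p.degree < (Polynomial.X ^ D : Polynomial ℝ).degree := by
    rw [Polynomial.degree_X_pow]
    exact Polynomial.degree_le_natDegree.trans_lt (by exact_mod_cast hlt)
  have ht := (Polynomial.div_tendsto_atTop_zero_of_degree_lt _ _ hdeg).comp
    (tendsto_natCast_atTop_atTop (R := ℝ))
  obtain ⟨m, h1, h2⟩ := ((ht.eventually (gt_mem_nhds one_pos)).and
    (Filter.eventually_gt_atTop 0)).exists
  have hm : (0 : ℝ) < m := by exact_mod_cast h2
  simp only [Function.comp_apply, Polynomial.eval_pow, Polynomial.eval_X] at h1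
  rw [div_lt_one (by positivity)] at h1
  exact absurd ((pow_le_pow_left₀ hm.le (by linarith) D).trans (h m)) (not_le.2 h1)

theorem eval_aeval_polynomial {σ : Type*} (E : MvPolynomial σ ℝ) (f : σ → Polynomial ℝ) (x : ℝ) :
    (MvPolynomial.aeval f E).eval x = MvPolynomial.eval (fun i => (f i).eval x) E := by
  rw [MvPolynomial.aeval_def, ← Polynomial.coe_evalRingHom, MvPolynomial.hom_eval₂,
    MvPolynomial.eval, MvPolynomial.coe_eval₂Hom]
  congr 1
  ext; simp

theorem natDegree_aeval_le_degreeOf {σ : Type*} (E : MvPolynomial σ ℝ) (i : σ)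
    (f : σ → Polynomial ℝ) (hi : (f i).natDegree ≤ 1) (hf : ∀ j ≠ i, (f j).natDegree = 0) :
    (MvPolynomial.aeval f E).natDegree ≤ E.degreeOf i := by
  rw [MvPolynomial.aeval_def, MvPolynomial.eval₂]
  refine (Polynomial.natDegree_sum_le _ _).trans (Finset.sup_le fun s hs => ?_)
  simp_rw [Function.comp_apply, ← Polynomial.C_eq_algebraMap]
  refine (Polynomial.natDegree_C_mul_le _ _).trans ((Polynomial.natDegree_prod_le _ _).trans ?_)
  refine le_trans ?_ (MvPolynomial.monomial_le_degreeOf i hs)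
  calc ∑ j ∈ s.support, (f j ^ s j).natDegree ≤ ∑ j ∈ s.support, if j = i then s i else 0 := by
        refine Finset.sum_le_sum fun j _ => Polynomial.natDegree_pow_le.trans ?_
        split_ifs with h
        · subst h; exact mul_le_of_le_one_right (Nat.zero_le _) hi
        · simp [hf j h]
    _ ≤ s i := by
        rw [Finset.sum_ite_eq']
        split_ifs <;> simp

section LatticePolytope

variable {d k : ℕ}

/-- Joint Ehrhart polynomial together with the upper bounds on its degrees. -/
theorem exists_mvPolynomial_latticePointCount (P : Fin k → Set (Fin d → ℝ))
    (hP : ∀ i, IsLatticePolytope (P i)) :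
    ∃ E : MvPolynomial (Fin k) ℝ,
      (∀ n : Fin k → ℕ, MvPolynomial.eval (fun i => (n i : ℝ)) E =
        (latticePointCount (∑ i, (n i : ℝ) • P i) : ℝ)) ∧
      (∀ i, E.degreeOf i ≤ polytopeDim (P i)) ∧
      E.totalDegree ≤ polytopeDim (∑ i, P i) := by
  have hne := fun i => (hP i).nonempty
  choose V hV hPV using hP
  set g : (Σ i, V i) → Fin k := fun j => j.1 with hg
  set v : (Σ i, V i) → Fin d → ℤ := fun j => j.2.1 with hv
  have hvP : ∀ j, (fun l => (v j l : ℝ)) ∈ P (g j) := fun j => by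
    rw [hPV]
    exact subset_convexHull ℝ _ ⟨j.2.1, j.2.2, rfl⟩
  obtain ⟨T, O, hind, hpos, hcover, huniq⟩ := exists_halfOpen_decomposition (cayleyMap g v)
  have hO : ∀ B ∈ T, ∀ i, ∃ b ∈ B, b ∉ O B ∧ g b = i := by
    intro B hB i
    obtain ⟨b, hb, hbO, hbi⟩ := hpos B hB
      (LinearMap.proj i ∘ₗ LinearMap.fst ℝ (Fin k → ℝ) (Fin d → ℝ))
      (fun j => by rw [proj_cayleyMap_single]; split_ifs <;> norm_num) (by
        obtain ⟨x, hx⟩ := hV i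
        exact ⟨⟨i, x, hx⟩, by rw [proj_cayleyMap_single, if_pos rfl]; exact one_pos⟩)
    refine ⟨b, hb, hbO, ?_⟩
    rw [proj_cayleyMap_single] at hbi
    by_contra h
    rw [if_neg h] at hbi
    exact lt_irrefl _ hbi
  have hE : ∀ B, ∃ E : MvPolynomial (Fin k) ℝ, B ∈ T →
      (∀ n : Fin k → ℕ, ∃ Z : Finset (Fin d → ℤ),
        (∀ z, z ∈ Z ↔ ∃ y, IsHalfOpen B (O B) y ∧
          cayleyMap g v y = (fun i => (n i : ℝ), fun l => (z l : ℝ))) ∧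
        MvPolynomial.eval (fun i => (n i : ℝ)) E = Z.card) ∧
      (∀ i, E.degreeOf i ≤ (B.filter (g · = i)).card - 1) ∧
      E.totalDegree ≤ ∑ i, ((B.filter (g · = i)).card - 1) := by
    intro B
    by_cases hB : B ∈ T
    · obtain ⟨E, hE⟩ := exists_mvPolynomial_halfOpen (hind B hB) (hO B hB)
      exact ⟨E, fun _ => hE⟩
    · exact ⟨0, fun h => absurd h hB⟩
  choose E hE using hE
  refine ⟨∑ B ∈ T, E B, fun n => ?_, fun i => ?_, ?_⟩
  · have hZ : ∀ B, ∃ Z : Finset (Fin d → ℤ), B ∈ T → (∀ z, z ∈ Z ↔ ∃ y, IsHalfOpen B (O B) y ∧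
          cayleyMap g v y = (fun i => (n i : ℝ), fun l => (z l : ℝ))) ∧
        MvPolynomial.eval (fun i => (n i : ℝ)) (E B) = Z.card := by
      intro B
      by_cases hB : B ∈ T
      · obtain ⟨Z, hZ⟩ := (hE B hB).1 n
        exact ⟨Z, fun _ => hZ⟩
      · exact ⟨∅, fun h => absurd h hB⟩
    choose Z hZ using hZ
    have hset : {z : Fin d → ℤ | (fun l => (z l : ℝ)) ∈ ∑ i, (n i : ℝ) • P i} =
        ↑(T.biUnion Z) := by
      ext z
      simp only [hPV]
      rw [Set.mem_ofPred_eq, mem_sum_smul_convexHull_iff V hV n, Finset.mem_coe,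
        Finset.mem_biUnion]
      constructor
      · rintro ⟨x, hx, hxz⟩
        obtain ⟨B, hB, y, hy, hyx⟩ := hcover x hx
        exact ⟨B, hB, ((hZ B hB).1 z).2 ⟨y, hy, hyx.trans hxz⟩⟩
      · rintro ⟨B, hB, hz⟩
        obtain ⟨y, hy, hyz⟩ := ((hZ B hB).1 z).1 hz
        refine ⟨y, fun j => ?_, hyz⟩
        by_cases hj : j ∈ B
        · exact (hy.2 j hj).1
        · exact (hy.1 j hj).ge
    rw [latticePointCount, hset, Set.ncard_coe_finset, Finset.card_biUnion, map_sum]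
    · push_cast
      exact Finset.sum_congr rfl fun B hB => (hZ B hB).2
    · intro B hB B' hB' hBB'
      refine Finset.disjoint_left.2 fun z hz hz' => hBB' ?_
      obtain ⟨y, hy, hyz⟩ := ((hZ B hB).1 z).1 hz
      obtain ⟨y', hy', hyz'⟩ := ((hZ B' hB').1 z).1 hz'
      exact huniq B hB B' hB' y y' hy hy' (hyz.trans hyz'.symm)
  · refine (MvPolynomial.degreeOf_sum_le _ _ _).trans (Finset.sup_le fun B hB => ?_)
    refine ((hE B hB).2.1 i).trans ?_
    choose b hb _ hgb using hO B hB
    rw [← Finset.sum_singleton (fun i => (B.filter (g · = i)).card - 1) i]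
    refine sum_card_sub_one_le_finrank (hind B hB) hb hgb _ _ fun j _ hj => ?_
    rw [Finset.mem_singleton] at hj
    refine AffineSubspace.vsub_mem_direction (subset_affineSpan ℝ _ (hj ▸ hvP j))
      (subset_affineSpan ℝ _ ?_)
    have h := hvP (b (g j))
    rw [hgb] at h
    exact hj ▸ h
  · refine (MvPolynomial.totalDegree_finsetSum_le fun B hB => ?_)
    refine (hE B hB).2.2.trans ?_
    choose b hb _ hgb using hO B hB
    refine sum_card_sub_one_le_finrank (hind B hB) hb hgb _ _ fun j _ _ => ?_
    choose p hp using hne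
    have hmem : ∀ x ∈ P (g j), x + ∑ i ∈ Finset.univ.erase (g j), p i ∈ ∑ i, P i := by
      intro x hx
      rw [← Finset.add_sum_erase _ P (Finset.mem_univ (g j))]
      exact Set.add_mem_add hx (Set.finsetSum_mem_finsetSum _ _ _ fun i _ => hp i)
    have h := hvP (b (g j))
    rw [hgb] at h
    have := AffineSubspace.vsub_mem_direction (subset_affineSpan ℝ _ (hmem _ (hvP j)))
      (subset_affineSpan ℝ _ (hmem _ h))
    rwa [vsub_eq_sub, add_sub_add_right_eq_sub] at this

theorem polytopeDim_sum_le_totalDegree {P : Fin k → Set (Fin d → ℝ)}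
    (hP : ∀ i, IsLatticePolytope (P i)) {E : MvPolynomial (Fin k) ℝ}
    (hE : ∀ n : Fin k → ℕ, MvPolynomial.eval (fun i => (n i : ℝ)) E =
      (latticePointCount (∑ i, (n i : ℝ) • P i) : ℝ)) :
    polytopeDim (∑ i, P i) ≤ E.totalDegree := by
  set D := polytopeDim (∑ i, P i) with hD
  have hdeg := MvPolynomial.aeval_natDegree_le E le_rfl
    (fun _ => Polynomial.C (D : ℝ) * Polynomial.X) (n := 1)
    fun _ => (Polynomial.natDegree_C_mul_le _ _).trans Polynomial.natDegree_X_le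
  rw [mul_one] at hdeg
  refine le_trans (le_natDegree_of_pow_le_eval fun m => ?_) hdeg
  have h1 := hE fun _ => D * m
  rw [← Finset.smul_sum] at h1
  rw [eval_aeval_polynomial]
  simp only [Polynomial.eval_mul, Polynomial.eval_C, Polynomial.eval_X]
  push_cast at h1
  rw [h1]
  exact_mod_cast pow_le_latticePointCount (IsLatticePolytope.sum hP) m

theorem polytopeDim_le_degreeOf {P : Fin k → Set (Fin d → ℝ)}
    (hP : ∀ i, IsLatticePolytope (P i)) {E : MvPolynomial (Fin k) ℝ}
    (hE : ∀ n : Fin k → ℕ, MvPolynomial.eval (fun i => (n i : ℝ)) E =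
      (latticePointCount (∑ i, (n i : ℝ) • P i) : ℝ)) (i : Fin k) :
    polytopeDim (P i) ≤ E.degreeOf i := by
  set D := polytopeDim (P i) with hD
  have hdeg := natDegree_aeval_le_degreeOf E i
    (fun j => if j = i then Polynomial.C (D : ℝ) * Polynomial.X else 0)
    (by rw [if_pos rfl]; exact (Polynomial.natDegree_C_mul_le _ _).trans Polynomial.natDegree_X_le)
    fun j hj => by rw [if_neg hj, Polynomial.natDegree_zero]
  refine le_trans (le_natDegree_of_pow_le_eval fun m => ?_) hdeg
  have h1 := hE fun j => if j = i then D * m else 0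
  have h2 : ∑ j, ((if j = i then D * m else 0 : ℕ) : ℝ) • P j = ((D * m : ℕ) : ℝ) • P i := by
    rw [Finset.sum_eq_single i, if_pos rfl]
    · intro j _ hj
      rw [if_neg hj, Nat.cast_zero, Set.zero_smul_set (hP j).nonempty]
    · simp
  rw [h2] at h1
  have h3 : (fun j => (if j = i then Polynomial.C (D : ℝ) * Polynomial.X else 0).eval (m : ℝ)) =
      fun j => ((if j = i then D * m else 0 : ℕ) : ℝ) := by
    funext j
    split_ifs <;> simp
  rw [eval_aeval_polynomial, h3, h1]
  exact_mod_cast pow_le_latticePointCount (hP i) m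

end LatticePolytope

/-- **Bernstein–McMullen.** For lattice polytopes `P_1, …, P_k ⊆ ℝ^d` there is a
polynomial `E` in `k` variables with `E(n_1,…,n_k) = |(n_1 P_1 + ⋯ + n_k P_k) ∩ ℤ^d|`
for all non-negative integers `n_i`; the degree of `E` in the `i`-th variable is
`dim P_i` and its total degree is `dim (P_1 + ⋯ + P_k)`. -/
theorem bernstein_mcmullen
    {d k : ℕ} (P : Fin k → Set (Fin d → ℝ))
    (hP : ∀ i, IsLatticePolytope (P i)) :
    ∃ E : MvPolynomial (Fin k) ℝ,
      (∀ n : Fin k → ℕ,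
        MvPolynomial.eval (fun i => (n i : ℝ)) E
          = (latticePointCount (∑ i, (n i : ℝ) • P i) : ℝ)) ∧
      (∀ i, MvPolynomial.degreeOf i E = polytopeDim (P i)) ∧
      E.totalDegree = polytopeDim (∑ i, P i) := by
  obtain ⟨E, hE, hdeg, htot⟩ := exists_mvPolynomial_latticePointCount P hP
  exact ⟨E, hE, fun i => (hdeg i).antisymm (polytopeDim_le_degreeOf hP hE i),
    htot.antisymm (polytopeDim_sum_le_totalDegree hP hE)⟩
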